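/- Let A be an n×n Hermitian matrix in block form A = [[B, D],[D*, C]]. Then 𝓔(A) ≥ 2𝓔(D), where 𝓔(M) denotes the sum of the absolute values of the eigenvalues of a Hermitian matrix M, and 𝓔(D) is the sum of the singular values of D. -/

import Mathlib

open Matrix Finset

theorem ker_lem {n E F : Type*} [Fintype n] [NormedAddCommGroup E] [InnerProductSpace ℂ E]
    [NormedAddCommGroup F] [InnerProductSpace ℂ F] {m : Type*} [Fintype m] [DecidableEq m] (d : E → F)
    (l : n → ℝ) (x : n → F) (y : n → E) (hxy : ∀ i, ‖x i‖ ^ 2 + ‖y i‖ ^ 2 = 1)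
    (hd : ∀ v, d v = ∑ i, ((l i : ℂ) * inner ℂ (y i) v) • x i)
    (v : m → E) (hv : Orthonormal ℂ v) (s : m → ℝ)
    (hs : ∀ j k, inner ℂ (d (v j)) (d (v k)) = if j = k then ((s k : ℂ)) ^ 2 else 0) :
    2 * ∑ j, s j ≤ ∑ i, |l i| := by
  classical
  set w : m → F := fun j => ((s j : ℂ)⁻¹) • d (v j) with hw
  have hsj : ∀ j, inner ℂ (w j) (d (v j)) = (s j : ℂ) := by
    intro j
    simp only [hw, inner_smul_left, hs, if_true]
    by_cases h : s j = 0
    · simp [h]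
    · have : (s j : ℂ) ≠ 0 := by exact_mod_cast h
      simp; field_simp
  have hwB : ∀ z : F, ∑ j, ‖inner ℂ (w j) z‖ ^ 2 ≤ ‖z‖ ^ 2 := by
    intro z
    have ho : Orthonormal ℂ (fun j : {j // s j ≠ 0} => w j) := by
      rw [orthonormal_iff_ite]
      rintro ⟨j, hj⟩ ⟨k, hk⟩
      have hj' : (s j : ℂ) ≠ 0 := by exact_mod_cast hj
      simp only [hw, inner_smul_left, inner_smul_right, hs, Subtype.mk.injEq]
      split_ifs with h
      · subst h
        simp; field_simp
      · simp
    have := ho.sum_inner_products_le z (s := Finset.univ)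
    refine le_trans (le_of_eq ?_) this
    rw [← Finset.sum_subtype (p := fun j => s j ≠ 0) (Finset.univ.filter (fun j => s j ≠ 0))
      (by simp) (fun j => ‖inner ℂ (w j) z‖ ^ 2), Finset.sum_filter_of_ne]
    intro j _ h h0
    apply h
    simp [hw, h0]
  have key : ∀ j, 2 * s j ≤ ∑ i, |l i| * (‖inner ℂ (w j) (x i)‖ ^ 2 + ‖inner ℂ (v j) (y i)‖ ^ 2) := by
    intro j
    have h1 : ‖(s j : ℂ)‖ ≤ ∑ i, |l i| * (‖inner ℂ (w j) (x i)‖ * ‖inner ℂ (v j) (y i)‖) := by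
      rw [← hsj j, hd, inner_sum]
      refine (norm_sum_le _ _).trans (Finset.sum_le_sum fun i _ => le_of_eq ?_)
      rw [inner_smul_right, norm_mul, norm_mul, norm_inner_symm (y i)]
      simp; ring
    have h2 : s j ≤ ‖(s j : ℂ)‖ := by simpa using le_abs_self (s j)
    calc 2 * s j ≤ 2 * ∑ i, |l i| * (‖inner ℂ (w j) (x i)‖ * ‖inner ℂ (v j) (y i)‖) := by linarith
      _ ≤ _ := by
        rw [Finset.mul_sum]
        refine Finset.sum_le_sum fun i _ => ?_
        have := mul_le_mul_of_nonneg_left (two_mul_le_add_sq (‖inner ℂ (w j) (x i)‖) (‖inner ℂ (v j) (y i)‖)) (abs_nonneg (l i))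
        linarith
  calc 2 * ∑ j, s j = ∑ j, 2 * s j := Finset.mul_sum _ _ _
    _ ≤ _ := Finset.sum_le_sum fun j _ => key j
    _ = ∑ i, |l i| * (∑ j, ‖inner ℂ (w j) (x i)‖ ^ 2 + ∑ j, ‖inner ℂ (v j) (y i)‖ ^ 2) := by
        rw [Finset.sum_comm]
        simp only [← Finset.mul_sum, Finset.sum_add_distrib]
    _ ≤ ∑ i, |l i| := by
        refine Finset.sum_le_sum fun i _ => ?_
        have h1 := hwB (x i)
        have h2 := hv.sum_inner_products_le (y i) (s := Finset.univ)
        have := hxy i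
        exact mul_le_of_le_one_right (abs_nonneg _) (by linarith)

open scoped ComplexOrder in
theorem psd_aux {p q : ℕ} (D : Matrix (Fin p) (Fin q) ℂ) (hDD : (Dᴴ * D).IsHermitian) (k : Fin q) :
    0 ≤ hDD.eigenvalues k :=
  (Matrix.posSemidef_conjTranspose_mul_self D).eigenvalues_nonneg k

/-- for a Hermitian block matrix `A = [[B, D], [Dᴴ, C]]`, the energy (sum of
absolute values of eigenvalues) satisfies `𝓔(A) ≥ 2 𝓔(D)`, where `𝓔(D)` is the sum of the
singular values of `D` (the square roots of the eigenvalues of `Dᴴ D`). -/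
theorem block_energy_ineq (p q : ℕ)
    (B : Matrix (Fin p) (Fin p) ℂ) (C : Matrix (Fin q) (Fin q) ℂ)
    (D : Matrix (Fin p) (Fin q) ℂ)
    (hB : B.IsHermitian) (hC : C.IsHermitian)
    (hA : (Matrix.fromBlocks B D Dᴴ C).IsHermitian)
    (hDD : (Dᴴ * D).IsHermitian) :
    2 * (∑ j, Real.sqrt (hDD.eigenvalues j)) ≤ ∑ i, |hA.eigenvalues i| := by
  have hinner : ∀ {r : ℕ} (a b : EuclideanSpace ℂ (Fin r)), inner ℂ a b = star a.ofLp ⬝ᵥ b.ofLp := by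
    intro r a b
    rw [EuclideanSpace.inner_eq_star_dotProduct, dotProduct_comm]
  refine ker_lem (fun v : EuclideanSpace ℂ (Fin q) => WithLp.toLp 2 (D *ᵥ v.ofLp)) hA.eigenvalues
    (fun i => WithLp.toLp 2 fun k => hA.eigenvectorBasis i (Sum.inl k))
    (fun i => WithLp.toLp 2 fun k => hA.eigenvectorBasis i (Sum.inr k)) ?_ ?_
    hDD.eigenvectorBasis hDD.eigenvectorBasis.orthonormal _ ?_
  · intro i
    have := hA.eigenvectorBasis.orthonormal.1 i
    have h2 : ‖hA.eigenvectorBasis i‖ ^ 2 = 1 := by rw [this]; norm_num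
    rw [EuclideanSpace.norm_sq_eq, Fintype.sum_sum_type] at h2
    simpa [EuclideanSpace.norm_sq_eq] using h2
  · intro v
    let z : EuclideanSpace ℂ (Fin p ⊕ Fin q) := WithLp.toLp 2 (Sum.elim 0 v.ofLp)
    have hz := hA.eigenvectorBasis.sum_repr' z
    have hz' : z.ofLp = ∑ i, inner ℂ (hA.eigenvectorBasis i) z • (hA.eigenvectorBasis i).ofLp := by
      conv_lhs => rw [← hz]
      simp
    have h3 : (Matrix.fromBlocks B D Dᴴ C) *ᵥ z.ofLp = Sum.elim (D *ᵥ v.ofLp) (C *ᵥ v.ofLp) := by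
      simp [z, Matrix.fromBlocks_mulVec]
    rw [hz'] at h3
    simp only [Matrix.mulVec_sum, Matrix.mulVec_smul, hA.mulVec_eigenvectorBasis] at h3
    ext k
    have h4 := congrFun h3 (Sum.inl k)
    simp only [Sum.elim_inl] at h4
    simp only [← h4]
    simp only [WithLp.ofLp_sum, WithLp.ofLp_smul, Finset.sum_apply, Pi.smul_apply, smul_eq_mul]
    refine Finset.sum_congr rfl fun i _ => ?_
    have : inner ℂ (hA.eigenvectorBasis i) z = inner ℂ (WithLp.toLp 2 fun k => hA.eigenvectorBasis i (Sum.inr k)) v := by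
      simp [PiLp.inner_apply, z]
    rw [this]
    simp only [Complex.real_smul]
    ring
  · intro j k
    have hn : 0 ≤ hDD.eigenvalues k := psd_aux D hDD k
    rw [← Complex.ofReal_pow, Real.sq_sqrt hn, hinner]
    simp only [Matrix.star_mulVec]
    rw [← Matrix.dotProduct_mulVec, Matrix.mulVec_mulVec, hDD.mulVec_eigenvectorBasis]
    have := orthonormal_iff_ite.1 hDD.eigenvectorBasis.orthonormal j k
    rw [hinner] at this
    rw [dotProduct_smul, this]
    split_ifs <;> simp
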